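/- The ideal I_ε^x ∩ I_ε^y ∩ I_ε^z is a real ideal: if f_1, …, f_m ∈ R satisfy f_1² + ⋯ + f_m² ∈ I_ε^x ∩ I_ε^y ∩ I_ε^z, then f_t ∈ I_ε^x ∩ I_ε^y ∩ I_ε^z for every t ∈ {1,…,m}. -/

import Mathlib

open MvPolynomial

/-- A family of real polynomials whose squares sum to zero vanishes. -/
theorem eq_zero_of_sum_sq_eq_zero {σ τ : Type*} [Fintype τ] {f : τ → MvPolynomial σ ℝ}
    (h : ∑ t, f t ^ 2 = 0) (t : τ) : f t = 0 := by
  refine MvPolynomial.funext fun x => ?_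
  have hx := congrArg (eval x) h
  simp only [map_sum, map_pow, map_zero] at hx
  rw [map_zero]
  exact pow_eq_zero_iff two_ne_zero |>.1
    ((Finset.sum_eq_zero_iff_of_nonneg fun _ _ => sq_nonneg _).1 hx t (Finset.mem_univ t))

/-- The ideal generated by `X (a, i) - ε i * X (b, i)` is the kernel of the substitution
`X (a, i) ↦ ε i * X (b, i)`. -/
theorem mem_span_X_sub_C_mul_X_iff {R κ ι : Type*} [CommRing R] [DecidableEq κ] {a b : κ}
    (hab : b ≠ a) (ε : ι → R) (p : MvPolynomial (κ × ι) R) :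
    p ∈ Ideal.span {q : MvPolynomial (κ × ι) R |
        ∃ i : ι, q = X (a, i) - C (ε i) * X (b, i)} ↔
      aeval (fun v : κ × ι => if v.1 = a then C (ε v.2) * X (b, v.2)
        else (X v : MvPolynomial (κ × ι) R)) p = 0 := by
  set I := Ideal.span {q : MvPolynomial (κ × ι) R |
    ∃ i : ι, q = X (a, i) - C (ε i) * X (b, i)} with hI
  set φ : MvPolynomial (κ × ι) R →ₐ[R] MvPolynomial (κ × ι) R :=
    aeval (fun v : κ × ι => if v.1 = a then C (ε v.2) * X (b, v.2) else X v) with hφ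
  constructor
  · intro hp
    have hle : I ≤ RingHom.ker φ := by
      rw [hI, Ideal.span_le]
      rintro _ ⟨i, rfl⟩
      simp [hφ, hab, RingHom.mem_ker, algHom_C, algebraMap_eq]
    exact hle hp
  · intro hp
    have hcomp : (Ideal.Quotient.mkₐ R I).comp φ = Ideal.Quotient.mkₐ R I := by
      refine algHom_ext fun v => ?_
      obtain ⟨c, i⟩ := v
      by_cases hc : c = a
      · subst hc
        simp only [hφ, AlgHom.comp_apply, aeval_X, if_true, Ideal.Quotient.mkₐ_eq_mk]
        have hmem : X (c, i) - C (ε i) * X (b, i) ∈ I := Ideal.subset_span ⟨i, rfl⟩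
        exact (Ideal.Quotient.eq.2 hmem).symm
      · simp [hφ, hc]
    have h := DFunLike.congr_fun hcomp p
    rw [AlgHom.comp_apply, hp, map_zero] at h
    exact Ideal.Quotient.eq_zero_iff_mem.1 h.symm

/-- The ideal generated by `X (a, i) - ε i * X (b, i)` is real. -/
theorem mem_span_X_sub_C_mul_X_of_sum_sq_mem {κ ι τ : Type*} [Fintype τ] {a b : κ}
    (hab : b ≠ a) (ε : ι → ℝ) {f : τ → MvPolynomial (κ × ι) ℝ}
    (h : ∑ t, f t ^ 2 ∈ Ideal.span {q : MvPolynomial (κ × ι) ℝ |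
      ∃ i : ι, q = X (a, i) - C (ε i) * X (b, i)}) (t : τ) :
    f t ∈ Ideal.span {q : MvPolynomial (κ × ι) ℝ |
      ∃ i : ι, q = X (a, i) - C (ε i) * X (b, i)} := by
  classical
  rw [mem_span_X_sub_C_mul_X_iff hab] at h ⊢
  simp only [map_sum, map_pow] at h
  exact eq_zero_of_sum_sq_eq_zero h t

/-- The ideal `I_ε^x ∩ I_ε^y ∩ I_ε^z` of
`ℝ[x_1,…,x_N,y_1,…,y_N,z_1,…,z_N]` is a real ideal: if a finite sum of squares
`f_1² + ⋯ + f_m²` belongs to it, then each `f_t` belongs to it. Variables are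
encoded by `Fin 3 × Fin N`, `(0,i) ↦ x_i`, `(1,i) ↦ y_i`, `(2,i) ↦ z_i`. -/
theorem stmt_3 (N : ℕ) (hN : 0 < N) (ε : Fin N → ℝ) (hε : ∀ i, ε i = 1 ∨ ε i = -1)
    (m : ℕ) (f : Fin m → MvPolynomial (Fin 3 × Fin N) ℝ)
    (hf : (∑ t : Fin m, (f t) ^ 2) ∈
        Ideal.span {q : MvPolynomial (Fin 3 × Fin N) ℝ |
            ∃ i : Fin N, q = X (1, i) - C (ε i) * X (2, i)} ⊓
        Ideal.span {q : MvPolynomial (Fin 3 × Fin N) ℝ |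
            ∃ i : Fin N, q = X (2, i) - C (ε i) * X (0, i)} ⊓
        Ideal.span {q : MvPolynomial (Fin 3 × Fin N) ℝ |
            ∃ i : Fin N, q = X (0, i) - C (ε i) * X (1, i)}) :
    ∀ t : Fin m, f t ∈
        Ideal.span {q : MvPolynomial (Fin 3 × Fin N) ℝ |
            ∃ i : Fin N, q = X (1, i) - C (ε i) * X (2, i)} ⊓
        Ideal.span {q : MvPolynomial (Fin 3 × Fin N) ℝ |
            ∃ i : Fin N, q = X (2, i) - C (ε i) * X (0, i)} ⊓
        Ideal.span {q : MvPolynomial (Fin 3 × Fin N) ℝ |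
            ∃ i : Fin N, q = X (0, i) - C (ε i) * X (1, i)} := by
  exact fun t =>
    ⟨⟨mem_span_X_sub_C_mul_X_of_sum_sq_mem (by decide) ε hf.1.1 t,
      mem_span_X_sub_C_mul_X_of_sum_sq_mem (by decide) ε hf.1.2 t⟩,
      mem_span_X_sub_C_mul_X_of_sum_sq_mem (by decide) ε hf.2 t⟩
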